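/- Let X be a Banach space, A : X → X a bounded linear operator with ‖A‖ ≤ q < 1, and Y a Banach space. Let f : X → Y be a C^∞ map with f(0) = 0 whose derivatives of every order are bounded on every bounded subset of X. Then the series g(x) = −Σ_{k=0}^{∞} f(A^k x) converges (uniformly with all derivatives on bounded sets) to a C^∞ function g : X → Y solving the cohomological equation g(Ax) − g(x) = f(x) for all x ∈ X. -/

import Mathlib

open Metric in
/-- A series of `C^N` functions whose iterated derivatives up to order `N` are dominated on every
ball by a summable sequence is of class `C^N`. -/
theorem contDiff_tsum_of_summable_on_ball {ι E F : Type*} [NormedAddCommGroup E] [NormedSpace ℝ E]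
    [NormedAddCommGroup F] [NormedSpace ℝ F] [CompleteSpace F] {N : ℕ∞} {f : ι → E → F}
    (hf : ∀ i, ContDiff ℝ N (f i))
    (h : ∀ (m : ℕ), (m : ℕ∞) ≤ N → ∀ R : ℝ, ∃ u : ι → ℝ, Summable u ∧
      ∀ i, ∀ x ∈ ball (0 : E) R, ‖iteratedFDeriv ℝ m (f i) x‖ ≤ u i) :
    ContDiff ℝ N fun x => ∑' i, f i x := by
  have mem (x : E) : x ∈ ball (0 : E) (‖x‖ + 1) := by simp
  have series : HasFTaylorSeriesUpTo N (fun x => ∑' i, f i x)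
      fun x m => ∑' i, iteratedFDeriv ℝ m (f i) x := by
    refine ⟨fun x => ?_, fun m hm x => ?_, fun m hm => ?_⟩
    · have := (continuousMultilinearCurryFin0 ℝ E F).toContinuousLinearEquiv.map_tsum
        (f := fun i => iteratedFDeriv ℝ 0 (f i) x) (L := .unconditional ι)
      refine this.trans ?_
      simp [iteratedFDeriv_zero_eq_comp]
    · have hm' : (m : ℕ∞) < N := mod_cast hm
      have hm1 : ((m + 1 : ℕ) : ℕ∞) ≤ N := by
        simpa only [ENat.natCast_add, ENat.natCast_one] using Order.add_one_le_of_lt hm'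
      obtain ⟨u, hu, hub⟩ := h (m + 1) hm1 (‖x‖ + 1)
      obtain ⟨v, hv, hvb⟩ := h m hm'.le (‖x‖ + 1)
      have key := hasFDerivAt_tsum_of_isPreconnected (f := fun i => iteratedFDeriv ℝ m (f i))
        (f' := fun i => fderiv ℝ (iteratedFDeriv ℝ m (f i))) hu isOpen_ball
        (convex_ball (0 : E) (‖x‖ + 1)).isPreconnected
        (fun i y _ => (((hf i).differentiable_iteratedFDeriv hm) y).hasFDerivAt)
        (fun i y hy => by
          rw [fderiv_iteratedFDeriv, Function.comp_apply, LinearIsometryEquiv.norm_map]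
          exact hub i y hy)
        (mem x) (.of_norm_bounded hv fun i => hvb i x (mem x)) (mem x)
      refine key.congr_fderiv ?_
      have := (continuousMultilinearCurryLeftEquiv ℝ
        (fun _ : Fin (m + 1) => E) F).toContinuousLinearEquiv.map_tsum
        (f := fun i => iteratedFDeriv ℝ (m + 1) (f i) x) (L := .unconditional ι)
      refine Eq.trans ?_ this.symm
      simp [fderiv_iteratedFDeriv]
    · have hm' : (m : ℕ∞) ≤ N := mod_cast hm
      refine continuous_iff_continuousAt.2 fun x => ?_
      obtain ⟨u, hu, hub⟩ := h m hm' (‖x‖ + 1)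
      exact (continuousOn_tsum
        (fun i => ((hf i).continuous_iteratedFDeriv hm).continuousOn) hu hub).continuousAt
        (isOpen_ball.mem_nhds (mem x))
  exact series.contDiff

theorem ContinuousLinearMap.norm_pow_le_of_norm_le {E : Type*} [NormedAddCommGroup E]
    [NormedSpace ℝ E] {A : E →L[ℝ] E} {q : ℝ} (hA : ‖A‖ ≤ q) (k : ℕ) : ‖A ^ k‖ ≤ q ^ k := by
  induction k with
  | zero => exact (pow_zero q).symm ▸ ContinuousLinearMap.norm_id_le
  | succ k ih =>
    rw [pow_succ, pow_succ]
    exact (norm_mul_le _ _).trans (by gcongr; exact (norm_nonneg _).trans ih)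

open Metric in
/-- On every ball, the iterated derivatives of `f ∘ A ^ k` decay geometrically in `k`. -/
theorem exists_norm_iteratedFDeriv_comp_pow_le {X Y : Type*} [NormedAddCommGroup X]
    [NormedSpace ℝ X] [NormedAddCommGroup Y] [NormedSpace ℝ Y] {A : X →L[ℝ] X} {q : ℝ}
    (hq : q < 1) (hA : ‖A‖ ≤ q) {f : X → Y} (hf : ContDiff ℝ (⊤ : ℕ∞) f) (hf0 : f 0 = 0)
    (hfbdd : ∀ (n : ℕ) (S : Set X), Bornology.IsBounded S →
      ∃ C : ℝ, ∀ x ∈ S, ‖iteratedFDeriv ℝ n f x‖ ≤ C) (n : ℕ) (R : ℝ) :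
    ∃ C : ℝ, ∀ k : ℕ, ∀ x ∈ ball (0 : X) R,
      ‖iteratedFDeriv ℝ n (fun y => f ((A ^ k) y)) x‖ ≤ C * q ^ k := by
  have hq0 : 0 ≤ q := (norm_nonneg A).trans hA
  have hpow := ContinuousLinearMap.norm_pow_le_of_norm_le hA
  have happ (k : ℕ) (x : X) : ‖(A ^ k) x‖ ≤ q ^ k * ‖x‖ := (A ^ k).le_of_opNorm_le (hpow k) x
  have hmaps (k : ℕ) {x : X} (hx : x ∈ ball (0 : X) R) : (A ^ k) x ∈ ball (0 : X) R := by
    rw [mem_ball_zero_iff] at hx ⊢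
    exact ((happ k x).trans
      (mul_le_of_le_one_left (norm_nonneg x) (pow_le_one₀ hq0 hq.le))).trans_lt hx
  rcases n with _ | n
  · obtain ⟨C, hC⟩ := hfbdd 1 (ball 0 R) isBounded_ball
    refine ⟨C * R, fun k x hx => ?_⟩
    have hxR : ‖x‖ < R := mem_ball_zero_iff.1 hx
    have h0 : (0 : X) ∈ ball (0 : X) R := mem_ball_self ((norm_nonneg x).trans_lt hxR)
    have hC0 : 0 ≤ C := (norm_nonneg _).trans (hC 0 h0)
    have hlip := (convex_ball (0 : X) R).norm_image_sub_le_of_norm_fderiv_le (𝕜 := ℝ)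
      (fun y _ => hf.differentiable (by simp) y)
      (fun y hy => (norm_iteratedFDeriv_one (𝕜 := ℝ) (f := f)).symm.trans_le (hC y hy))
      h0 (hmaps k hx)
    rw [hf0, sub_zero, sub_zero] at hlip
    rw [norm_iteratedFDeriv_zero]
    calc ‖f ((A ^ k) x)‖ ≤ C * (q ^ k * ‖x‖) := hlip.trans (by gcongr; exact happ k x)
      _ ≤ C * (q ^ k * R) := by gcongr
      _ = C * R * q ^ k := by ring
  · obtain ⟨C, hC⟩ := hfbdd (n + 1) (ball 0 R) isBounded_ball
    refine ⟨C, fun k x hx => ?_⟩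
    have hC' := hC _ (hmaps k hx)
    have hC0 : 0 ≤ C := (norm_nonneg _).trans hC'
    have hcomp := (A ^ k).iteratedFDeriv_comp_right hf x (i := n + 1) (mod_cast le_top)
    calc ‖iteratedFDeriv ℝ (n + 1) (fun y => f ((A ^ k) y)) x‖
        ≤ ‖iteratedFDeriv ℝ (n + 1) f ((A ^ k) x)‖ * ∏ _i : Fin (n + 1), ‖A ^ k‖ :=
          (congrArg norm hcomp).trans_le
            (ContinuousMultilinearMap.norm_compContinuousLinearMap_le _ _)
      _ ≤ C * (q ^ k) ^ (n + 1) := by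
          rw [Finset.prod_const, Finset.card_univ, Fintype.card_fin]
          gcongr
          exact hpow k
      _ ≤ C * q ^ k := by
          gcongr
          exact pow_le_of_le_one (pow_nonneg hq0 k) (pow_le_one₀ hq0 hq.le) n.succ_ne_zero

theorem stmt_11
    {X Y : Type*} [NormedAddCommGroup X] [NormedSpace ℝ X] [CompleteSpace X]
    [NormedAddCommGroup Y] [NormedSpace ℝ Y] [CompleteSpace Y]
    (A : X →L[ℝ] X) (q : ℝ) (hq : q < 1) (hA : ‖A‖ ≤ q)
    (f : X → Y) (hf : ContDiff ℝ (⊤ : ℕ∞) f) (hf0 : f 0 = 0)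
    (hfbdd : ∀ (n : ℕ) (S : Set X), Bornology.IsBounded S →
      ∃ C : ℝ, ∀ x ∈ S, ‖iteratedFDeriv ℝ n f x‖ ≤ C) :
    ∃ g : X → Y, ContDiff ℝ (⊤ : ℕ∞) g ∧
      (∀ x, HasSum (fun k : ℕ => f ((A ^ k) x)) (-(g x))) ∧
      (∀ x, g (A x) - g x = f x) := by
  have hgeom : Summable fun k : ℕ => q ^ k :=
    summable_geometric_of_lt_one ((norm_nonneg A).trans hA) hq
  have hbound := exists_norm_iteratedFDeriv_comp_pow_le hq hA hf hf0 hfbdd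
  have hsum (x : X) : Summable fun k : ℕ => f ((A ^ k) x) := by
    obtain ⟨C, hC⟩ := hbound 0 (‖x‖ + 1)
    refine .of_norm_bounded (hgeom.mul_left C) fun k => ?_
    simpa only [norm_iteratedFDeriv_zero] using hC k x (by simp)
  refine ⟨fun x => -∑' k : ℕ, f ((A ^ k) x), ?_, fun x => ?_, fun x => ?_⟩
  · refine (contDiff_tsum_of_summable_on_ball (fun k => hf.comp (A ^ k).contDiff)
      fun m _ R => ?_).neg
    obtain ⟨C, hC⟩ := hbound m R
    exact ⟨_, hgeom.mul_left C, hC⟩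
  · simpa only [neg_neg] using (hsum x).hasSum
  · have hshift := (hsum x).tsum_eq_zero_add
    simp only [pow_succ, pow_zero, mul_apply_eq_comp, one_apply_eq_self]
      at hshift
    simp only [hshift]
    abel
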